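/- arXiv:2506.08355 — 9 statements merged into one kernel-verified Lean document; each statement's English description precedes it below -/
import Mathlib

section
/- A complex number λ is an eigenvalue of H (viewed as a complex 2n×2n matrix) if and only if λ² is an eigenvalue of the product matrix K·M (viewed as a complex n×n matrix). -/
open Matrix

theorem exists_fromBlocks_zero_mulVec_eq_smul_iff {m F : Type*} [Fintype m] [DecidableEq m]
    [Field F] (A B : Matrix m m F) (hB : IsUnit B) (c : F) :
    (∃ v : m ⊕ m → F, v ≠ 0 ∧ fromBlocks 0 A B 0 *ᵥ v = c • v) ↔
      ∃ w : m → F, w ≠ 0 ∧ (A * B) *ᵥ w = c ^ 2 • w := by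
  have hinj : Function.Injective B.mulVec := mulVec_injective_of_isUnit hB
  constructor
  · rintro ⟨v, hv, h⟩
    obtain ⟨y, x, rfl⟩ : ∃ y x : m → F, v = Sum.elim y x := ⟨_, _, (Sum.elim_comp_inl_inr v).symm⟩
    have hx : A *ᵥ x = c • y := by
      ext i
      simpa [fromBlocks_mulVec] using congrFun h (Sum.inl i)
    have hy : B *ᵥ y = c • x := by
      ext i
      simpa [fromBlocks_mulVec] using congrFun h (Sum.inr i)
    by_cases hy0 : y = 0
    · subst hy0
      have hx0 : x ≠ 0 := by
        rintro rfl
        exact hv (by ext (i | i) <;> rfl)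
      have hc : c = 0 := by
        rw [mulVec_zero, eq_comm, smul_eq_zero] at hy
        exact hy.resolve_right hx0
      obtain ⟨w, rfl⟩ := mulVec_surjective_iff_isUnit.2 hB x
      refine ⟨w, ?_, ?_⟩
      · rintro rfl
        exact hx0 (mulVec_zero B)
      · rw [← mulVec_mulVec, hx, hc]
        simp
    · exact ⟨y, hy0, by rw [← mulVec_mulVec, hy, mulVec_smul, hx, smul_smul, sq]⟩
  · rintro ⟨w, hw, h⟩
    refine ⟨Sum.elim (c • w) (B *ᵥ w), fun h0 => hw (hinj ?_), ?_⟩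
    · ext i
      simpa using congrFun h0 (Sum.inr i)
    · ext (i | i)
      · simpa [fromBlocks_mulVec, sq, mul_assoc] using congrFun h i
      · simp [fromBlocks_mulVec, mulVec_smul]

/-- `λ ∈ ℂ` is an eigenvalue of `H = [[O, K], [M, O]]` (over `ℂ`) iff `λ²` is an
eigenvalue of `K * M` (over `ℂ`). -/
theorem stmt1 (n : ℕ) (hn : 0 < n) (K M : Matrix (Fin n) (Fin n) ℝ)
    (hK : K.PosSemidef) (hM : M.PosDef) (lam : ℂ) :
    (∃ v : (Fin n ⊕ Fin n) → ℂ, v ≠ 0 ∧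
        ((Matrix.fromBlocks 0 K M 0).map Complex.ofReal).mulVec v = lam • v) ↔
      (∃ w : Fin n → ℂ, w ≠ 0 ∧
        ((K * M).map Complex.ofReal).mulVec w = lam ^ 2 • w) := by
  have hfrom : (fromBlocks 0 K M 0).map Complex.ofReal =
      fromBlocks 0 (K.map Complex.ofReal) (M.map Complex.ofReal) 0 := by
    simp [fromBlocks_map]
  have hmul : (K * M).map Complex.ofReal = K.map Complex.ofReal * M.map Complex.ofReal :=
    Matrix.map_mul (f := Complex.ofRealHom)
  have hM' : IsUnit (M.map Complex.ofReal) := hM.isUnit.map Complex.ofRealHom.mapMatrix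
  rw [hfrom, hmul]
  exact exists_fromBlocks_zero_mulVec_eq_smul_iff _ _ hM' lam
end

section
/- Every complex eigenvalue λ of H is a real number, and for each such eigenvalue λ there exists a nonzero real vector [y; x] ∈ ℝ^{2n} with H·[y; x] = λ·[y; x]. -/
open Matrix

theorem mulVec_re_of_map_ofReal {m k : Type*} [Fintype k] (A : Matrix m k ℝ)
    (v : k → ℂ) (i : m) :
    ((A.map Complex.ofReal).mulVec v i).re = A.mulVec (fun j => (v j).re) i := by
  simp [Matrix.mulVec, dotProduct]

theorem mulVec_im_of_map_ofReal {m k : Type*} [Fintype k] (A : Matrix m k ℝ)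
    (v : k → ℂ) (i : m) :
    ((A.map Complex.ofReal).mulVec v i).im = A.mulVec (fun j => (v j).im) i := by
  simp [Matrix.mulVec, dotProduct]

theorem dotProduct_mulVec_comm_of_isHermitian {k : Type*} [Fintype k] {A : Matrix k k ℝ}
    (hA : A.IsHermitian) (u v : k → ℝ) : u ⬝ᵥ A *ᵥ v = v ⬝ᵥ A *ᵥ u := by
  have hT : Aᵀ = A := by simpa [Matrix.conjTranspose_eq_transpose_of_trivial] using hA.eq
  rw [dotProduct_mulVec, ← mulVec_transpose, hT, dotProduct_comm]

/-- The real and imaginary parts of a complex eigenvector of `[[O, K], [M, O]]` with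
eigenvalue `a + b i` satisfy the four real equations below, which force `b = 0`. -/
theorem im_eq_zero_of_re_im_equations {k : Type*} [Fintype k] {K M : Matrix k k ℝ}
    (hK : K.PosSemidef) (hM : M.PosDef) {a b : ℝ} {x₁ x₂ y₁ y₂ : k → ℝ}
    (hK₁ : K *ᵥ x₁ = a • y₁ - b • y₂) (hK₂ : K *ᵥ x₂ = a • y₂ + b • y₁)
    (hM₁ : M *ᵥ y₁ = a • x₁ - b • x₂) (hM₂ : M *ᵥ y₂ = a • x₂ + b • x₁)
    (hne : ¬ (x₁ = 0 ∧ x₂ = 0 ∧ y₁ = 0 ∧ y₂ = 0)) : b = 0 := by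
  by_contra hb
  have sK := dotProduct_mulVec_comm_of_isHermitian hK.isHermitian x₂ x₁
  have sM := dotProduct_mulVec_comm_of_isHermitian hM.isHermitian y₂ y₁
  have k₁ := hK.dotProduct_mulVec_nonneg x₁
  have k₂ := hK.dotProduct_mulVec_nonneg x₂
  have m₁ := hM.posSemidef.dotProduct_mulVec_nonneg y₁
  have m₂ := hM.posSemidef.dotProduct_mulVec_nonneg y₂
  have p₁ : y₁ ≠ 0 → 0 < y₁ ⬝ᵥ M *ᵥ y₁ := fun h => by
    simpa using hM.dotProduct_mulVec_pos h
  have p₂ : y₂ ≠ 0 → 0 < y₂ ⬝ᵥ M *ᵥ y₂ := fun h => by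
    simpa using hM.dotProduct_mulVec_pos h
  simp only [star_trivial, hK₁, hK₂, hM₁, hM₂, dotProduct_add, dotProduct_sub,
    dotProduct_smul, add_dotProduct, sub_dotProduct, smul_dotProduct, smul_eq_mul,
    dotProduct_comm x₁, dotProduct_comm x₂]
    at sK sM k₁ k₂ m₁ m₂ p₁ p₂
  have hP : b * (y₁ ⬝ᵥ x₁ + y₂ ⬝ᵥ x₂) = 0 := by linarith
  have hP' : y₁ ⬝ᵥ x₁ + y₂ ⬝ᵥ x₂ = 0 := (mul_eq_zero.mp hP).resolve_left hb
  have haP : a * (y₁ ⬝ᵥ x₁) + a * (y₂ ⬝ᵥ x₂) = 0 := by rw [← mul_add, hP', mul_zero]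
  have hy₁ : y₁ = 0 := by
    by_contra h
    linarith [p₁ h]
  have hy₂ : y₂ = 0 := by
    by_contra h
    linarith [p₂ h]
  subst hy₁ hy₂
  have hab : a ^ 2 + b ^ 2 ≠ 0 := by positivity
  have e₁ : ∀ i, a * x₁ i - b * x₂ i = 0 := fun i => by
    simpa using (congrFun hM₁ i).symm
  have e₂ : ∀ i, a * x₂ i + b * x₁ i = 0 := fun i => by
    simpa using (congrFun hM₂ i).symm
  refine hne ⟨funext fun i => ?_, funext fun i => ?_, rfl, rfl⟩
  · refine (mul_eq_zero.mp ?_).resolve_left hab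
    linear_combination a * e₁ i + b * e₂ i
  · refine (mul_eq_zero.mp ?_).resolve_left hab
    linear_combination a * e₂ i - b * e₁ i

/-- Every complex eigenvalue `λ` of `H = [[O, K], [M, O]]` is real, and there is a
nonzero real eigenvector of `H` associated with it. -/
theorem stmt3 (n : ℕ) (hn : 0 < n) (K M : Matrix (Fin n) (Fin n) ℝ)
    (hK : K.PosSemidef) (hM : M.PosDef) (lam : ℂ)
    (h : ∃ v : (Fin n ⊕ Fin n) → ℂ, v ≠ 0 ∧
        ((Matrix.fromBlocks 0 K M 0).map Complex.ofReal).mulVec v = lam • v) :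
    lam.im = 0 ∧ ∃ ξ : (Fin n ⊕ Fin n) → ℝ, ξ ≠ 0 ∧
      (Matrix.fromBlocks 0 K M 0).mulVec ξ = lam.re • ξ := by
  obtain ⟨v, hv, hev⟩ := h
  have hre : ∀ i, (Matrix.fromBlocks 0 K M 0).mulVec (fun j => (v j).re) i
      = lam.re * (v i).re - lam.im * (v i).im := fun i => by
    rw [← mulVec_re_of_map_ofReal, hev]
    simp
  have him : ∀ i, (Matrix.fromBlocks 0 K M 0).mulVec (fun j => (v j).im) i
      = lam.re * (v i).im + lam.im * (v i).re := fun i => by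
    rw [← mulVec_im_of_map_ofReal, hev]
    simp
  have hb : lam.im = 0 := by
    refine im_eq_zero_of_re_im_equations hK hM (a := lam.re)
      (x₁ := fun i => (v (.inr i)).re) (x₂ := fun i => (v (.inr i)).im)
      (y₁ := fun i => (v (.inl i)).re) (y₂ := fun i => (v (.inl i)).im)
      (funext fun i => ?_) (funext fun i => ?_) (funext fun i => ?_) (funext fun i => ?_) ?_
    · simpa [fromBlocks_mulVec, Function.comp_def] using hre (.inl i)
    · simpa [fromBlocks_mulVec, Function.comp_def] using him (.inl i)
    · simpa [fromBlocks_mulVec, Function.comp_def] using hre (.inr i)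
    · simpa [fromBlocks_mulVec, Function.comp_def] using him (.inr i)
    · rintro ⟨h₁, h₂, h₃, h₄⟩
      refine hv (funext fun i => ?_)
      rcases i with i | i
      · exact Complex.ext (congrFun h₃ i) (congrFun h₄ i)
      · exact Complex.ext (congrFun h₁ i) (congrFun h₂ i)
  refine ⟨hb, ?_⟩
  by_cases h0 : (fun j => (v j).re) = 0
  · refine ⟨fun j => (v j).im, fun h1 => hv (funext fun i => ?_), funext fun i => ?_⟩
    · exact Complex.ext (congrFun h0 i) (congrFun h1 i)
    · simp [him, hb]
  · exact ⟨fun j => (v j).re, h0, funext fun i => by simp [hre, hb]⟩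
end

section
/- For every real number λ, rank(λ·I_{2n} − H) = n + rank(λ²·I_n − K·M). -/
open Matrix

/-- The rank of a block diagonal matrix is the sum of the ranks of its blocks. -/
theorem Matrix.rank_fromBlocks_zero_zero {l m n o R : Type*} [Field R] [Fintype l] [Fintype m]
    [Fintype n] [Fintype o] (A : Matrix l m R) (D : Matrix n o R) :
    (fromBlocks A 0 0 D).rank = A.rank + D.rank := by
  let e := LinearEquiv.sumArrowLequivProdArrow l n R R
  let f := LinearEquiv.sumArrowLequivProdArrow m o R R
  have h : e.toLinearMap ∘ₗ (fromBlocks A 0 0 D).mulVecLin =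
      (A.mulVecLin.prodMap D.mulVecLin) ∘ₗ f.toLinearMap := by
    refine LinearMap.ext fun x => Prod.ext ?_ ?_ <;> ext i <;>
      simp [e, f, fromBlocks_mulVec, Function.comp_def] <;> rfl
  have hr : Module.finrank R (LinearMap.range (fromBlocks A 0 0 D).mulVecLin) =
      Module.finrank R (LinearMap.range (A.mulVecLin.prodMap D.mulVecLin)) := by
    rw [← LinearEquiv.finrank_map_eq e, ← LinearMap.range_comp, h, LinearMap.range_comp,
      LinearEquiv.range, Submodule.map_top]
  let prodEquiv (p : Submodule R (l → R)) (q : Submodule R (n → R)) :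
      p.prod q ≃ₗ[R] p × q :=
    { Equiv.Set.prod (p : Set (l → R)) (q : Set (n → R)) with
      map_add' := fun _ _ => rfl
      map_smul' := fun _ _ => rfl }
  rw [rank, rank, rank, hr, LinearMap.range_prodMap, (prodEquiv _ _).finrank_eq,
    Module.finrank_prod]

/-- For every real `λ`, `rank(λ I_{2n} - H) = n + rank(λ² I_n - K M)` where
`H = [[O, K], [M, O]]`. -/
theorem stmt5 (n : ℕ) (hn : 0 < n) (K M : Matrix (Fin n) (Fin n) ℝ)
    (hK : K.PosSemidef) (hM : M.PosDef) (lam : ℝ) :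
    (lam • (1 : Matrix (Fin n ⊕ Fin n) (Fin n ⊕ Fin n) ℝ) -
        Matrix.fromBlocks 0 K M 0).rank
      = n + (lam ^ 2 • (1 : Matrix (Fin n) (Fin n) ℝ) - K * M).rank := by
  have hM' : IsUnit M.det := hM.det_pos.ne'.isUnit
  have hl : M⁻¹ * M = 1 := nonsing_inv_mul M hM'
  have hr : M * M⁻¹ = 1 := mul_nonsing_inv M hM'
  have hL : IsUnit (fromBlocks 1 (lam • M⁻¹) 0 1 :
      Matrix (Fin n ⊕ Fin n) (Fin n ⊕ Fin n) ℝ).det := by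
    simp
  have hR : IsUnit (fromBlocks (lam • 1) (-M⁻¹) M 0 :
      Matrix (Fin n ⊕ Fin n) (Fin n ⊕ Fin n) ℝ).det := by
    refine isUnit_det_of_right_inverse (B := fromBlocks 0 M⁻¹ (-M) (lam • 1)) ?_
    simp [fromBlocks_multiply, hl, hr]
  have key : fromBlocks 1 (lam • M⁻¹) 0 1 *
      (lam • (1 : Matrix (Fin n ⊕ Fin n) (Fin n ⊕ Fin n) ℝ) - fromBlocks 0 K M 0) *
      fromBlocks (lam • 1) (-M⁻¹) M 0 =
      fromBlocks (lam ^ 2 • 1 - K * M) 0 0 1 := by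
    rw [← fromBlocks_one, fromBlocks_smul, sub_eq_add_neg, fromBlocks_neg, fromBlocks_add,
      fromBlocks_multiply, fromBlocks_multiply]
    simp [hl, hr, add_mul, smul_smul, pow_two, sub_eq_add_neg, add_comm]
  rw [← rank_mul_eq_right_of_isUnit_det _ _ hL, ← rank_mul_eq_left_of_isUnit_det _ _ hR, key,
    rank_fromBlocks_zero_zero, rank_one, Fintype.card_fin, add_comm]
end

section
/- Generalized nullspace of H: the nullspace of H^{2n} coincides with the nullspace of H², and a vector [y; x] ∈ ℝ^{2n} belongs to it if and only if K x = 0 and K (M y) = 0 (equivalently, M y lies in the nullspace of K). Moreover dim ker(H^{2n}) = 2·r, where r = dim ker(K). -/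
open Matrix

/-- The product of two submodules, as a submodule of the product, is their external product. -/
def Submodule.prodLinearEquiv {R V W : Type*} [Semiring R] [AddCommMonoid V] [Module R V]
    [AddCommMonoid W] [Module R W] (p : Submodule R V) (q : Submodule R W) :
    p.prod q ≃ₗ[R] p × q where
  toFun x := (⟨x.1.1, x.2.1⟩, ⟨x.1.2, x.2.2⟩)
  invFun x := ⟨(x.1, x.2), x.1.2, x.2.2⟩
  map_add' _ _ := rfl
  map_smul' _ _ := rfl
  left_inv _ := rfl
  right_inv _ := rfl

namespace Matrix

variable {n : Type*} [Fintype n] {K M : Matrix n n ℝ}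

theorem fromBlocks_zero_diag_sq_mulVec [DecidableEq n] (K M : Matrix n n ℝ) (v : n ⊕ n → ℝ) :
    (fromBlocks 0 K M 0 ^ 2) *ᵥ v =
      Sum.elim (K *ᵥ (M *ᵥ (v ∘ Sum.inl))) (M *ᵥ (K *ᵥ (v ∘ Sum.inr))) := by
  rw [sq, ← mulVec_mulVec, fromBlocks_mulVec, fromBlocks_mulVec]
  simp

theorem PosDef.mulVec_eq_zero_iff (hM : M.PosDef) {x : n → ℝ} : M *ᵥ x = 0 ↔ x = 0 := by
  refine ⟨fun h => ?_, fun h => by simp [h]⟩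
  by_contra hx
  have := hM.dotProduct_mulVec_pos hx
  simp [h] at this

theorem PosDef.mulVec_mulVec_mulVec_eq_zero_iff (hM : M.PosDef) (hK : K.IsHermitian)
    {x : n → ℝ} : K *ᵥ (M *ᵥ (K *ᵥ x)) = 0 ↔ K *ᵥ x = 0 := by
  refine ⟨fun h => ?_, fun h => by simp [h]⟩
  by_contra hx
  have hpos := hM.dotProduct_mulVec_pos hx
  have hK' : Kᵀ = K := by simpa using hK.eq
  have hzero : (K *ᵥ x) ⬝ᵥ (M *ᵥ (K *ᵥ x)) = 0 := by
    rw [dotProduct_comm, dotProduct_mulVec, ← mulVec_transpose, hK', h, zero_dotProduct]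
  exact hpos.ne' hzero

theorem PosDef.fromBlocks_zero_diag_sq_mulVec_eq_zero_iff [DecidableEq n] (hM : M.PosDef) {v : n ⊕ n → ℝ} :
    (fromBlocks 0 K M 0 ^ 2) *ᵥ v = 0 ↔
      K *ᵥ (v ∘ Sum.inr) = 0 ∧ K *ᵥ (M *ᵥ (v ∘ Sum.inl)) = 0 := by
  rw [fromBlocks_zero_diag_sq_mulVec, ← Sum.elim_zero_zero, Sum.elim_eq_iff,
    hM.mulVec_eq_zero_iff, and_comm]

theorem pow_mulVec_eq_zero_iff [DecidableEq n] {A : Matrix n n ℝ}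
    (hA : ∀ v, A *ᵥ (A *ᵥ v) = 0 → A *ᵥ v = 0)
    {k : ℕ} (hk : 0 < k) {v : n → ℝ} : (A ^ k) *ᵥ v = 0 ↔ A *ᵥ v = 0 := by
  induction k, hk using Nat.le_induction generalizing v with
  | base => simp
  | succ k _ ih =>
    rw [pow_succ, ← mulVec_mulVec, ih]
    exact ⟨hA v, fun h => by simp [h]⟩

theorem PosDef.fromBlocks_zero_diag_pow_mulVec_eq_zero_iff [DecidableEq n] (hM : M.PosDef)
    (hK : K.IsHermitian)
    {k : ℕ} (hk : 0 < k) {v : n ⊕ n → ℝ} :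
    (fromBlocks 0 K M 0 ^ (2 * k)) *ᵥ v = 0 ↔ (fromBlocks 0 K M 0 ^ 2) *ᵥ v = 0 := by
  rw [pow_mul]
  refine pow_mulVec_eq_zero_iff (fun w hw => ?_) hk
  rw [hM.fromBlocks_zero_diag_sq_mulVec_eq_zero_iff, fromBlocks_zero_diag_sq_mulVec,
    Sum.elim_comp_inr, Sum.elim_comp_inl, hM.mulVec_mulVec_mulVec_eq_zero_iff hK,
    hM.mulVec_mulVec_mulVec_eq_zero_iff hK] at hw
  exact hM.fromBlocks_zero_diag_sq_mulVec_eq_zero_iff.2 hw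

theorem PosDef.finrank_ker_fromBlocks_zero_diag_sq [DecidableEq n] (hM : M.PosDef) :
    Module.finrank ℝ (LinearMap.ker (fromBlocks 0 K M 0 ^ 2).mulVecLin) =
      2 * Module.finrank ℝ (LinearMap.ker K.mulVecLin) := by
  let eM : (n → ℝ) ≃ₗ[ℝ] (n → ℝ) := LinearEquiv.ofInjectiveEndo M.mulVecLin
    (LinearMap.ker_eq_bot.1 (LinearMap.ker_eq_bot'.2 fun x hx => hM.mulVec_eq_zero_iff.1 hx))
  let e : (n ⊕ n → ℝ) ≃ₗ[ℝ] (n → ℝ) × (n → ℝ) :=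
    LinearEquiv.sumArrowLequivProdArrow n n ℝ ℝ ≪≫ₗ eM.prodCongr (LinearEquiv.refl ℝ _)
  have hker : LinearMap.ker (fromBlocks 0 K M 0 ^ 2).mulVecLin =
      ((LinearMap.ker K.mulVecLin).prod (LinearMap.ker K.mulVecLin)).comap e.toLinearMap := by
    ext v
    rw [LinearMap.mem_ker, mulVecLin_apply, hM.fromBlocks_zero_diag_sq_mulVec_eq_zero_iff,
      and_comm]
    rfl
  rw [hker, (e.ofSubmodule' _).finrank_eq, (Submodule.prodLinearEquiv _ _).finrank_eq,
    Module.finrank_prod, two_mul]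

end Matrix



/-- The generalized nullspace of `H = [[O, K], [M, O]]`: `ker(H^{2n}) = ker(H²)`,
a vector `[y; x]` belongs to it iff `K x = 0` and `K (M y) = 0`, and its
dimension equals `2 r` with `r = dim ker(K)`. -/
theorem stmt10 (n : ℕ) (hn : 0 < n) (K M : Matrix (Fin n) (Fin n) ℝ)
    (hK : K.PosSemidef) (hM : M.PosDef) :
    (∀ x y : Fin n → ℝ,
        ((Matrix.fromBlocks 0 K M 0) ^ (2 * n)).mulVec (Sum.elim y x) = 0 ↔
          (K.mulVec x = 0 ∧ K.mulVec (M.mulVec y) = 0)) ∧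
    LinearMap.ker ((Matrix.fromBlocks 0 K M 0) ^ (2 * n)).mulVecLin
      = LinearMap.ker ((Matrix.fromBlocks 0 K M 0) ^ 2).mulVecLin ∧
    Module.finrank ℝ
        (LinearMap.ker ((Matrix.fromBlocks 0 K M 0) ^ (2 * n)).mulVecLin)
      = 2 * Module.finrank ℝ (LinearMap.ker K.mulVecLin) := by
  have hpow := @PosDef.fromBlocks_zero_diag_pow_mulVec_eq_zero_iff _ _ K M _ hM hK.isHermitian n hn
  have hker : LinearMap.ker ((Matrix.fromBlocks 0 K M 0) ^ (2 * n)).mulVecLin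
      = LinearMap.ker ((Matrix.fromBlocks 0 K M 0) ^ 2).mulVecLin := by
    ext v
    exact hpow
  refine ⟨fun x y => ?_, hker, ?_⟩
  · rw [hpow, hM.fromBlocks_zero_diag_sq_mulVec_eq_zero_iff, Sum.elim_comp_inl,
      Sum.elim_comp_inr]
  · rw [hker, hM.finrank_ker_fromBlocks_zero_diag_sq]
end

section
/- Direct sum decomposition into biorthogonal invariant subspaces (matrix form): there exist matrices X, Y ∈ ℝ^{n×n} with Xᵀ Y = I_n (hence both invertible) and diagonal matrices Λ, D ∈ ℝ^{n×n} with all diagonal entries of Λ nonnegative and all diagonal entries of D positive, such that K·X = Y·Λ, M·Y = X·D, and for each index i: if Λ_{ii} > 0 then D_{ii} = Λ_{ii}, while if Λ_{ii} = 0 then D_{ii} = 1. Moreover, the number of indices i with Λ_{ii} = 0 equals dim ker(K). (The columns of X and Y with Λ_{ii} > 0 are biorthogonal eigenvector pairs of H with eigenvalues ±Λ_{ii}, and the columns with Λ_{ii} = 0 span the generalized nullspace.) -/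
open Matrix

open scoped MatrixOrder in
/-- A real symmetric positive definite matrix is `B * Bᵀ` for some invertible `B`. -/
theorem Matrix.PosDef.exists_eq_mul_transpose {ι : Type*} [Fintype ι] [DecidableEq ι]
    {M : Matrix ι ι ℝ} (hM : M.PosDef) : ∃ B : Matrix ι ι ℝ, IsUnit B.det ∧ M = B * Bᵀ := by
  obtain ⟨A, hA⟩ := CStarAlgebra.nonneg_iff_eq_star_mul_self.mp hM.posSemidef.nonneg
  rw [star_eq_conjTranspose, conjTranspose_eq_transpose_of_trivial] at hA
  refine ⟨Aᵀ, ?_, by rwa [transpose_transpose]⟩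
  have hdet := hM.det_pos
  rw [hA, det_mul] at hdet
  exact isUnit_iff_ne_zero.mpr (left_ne_zero_of_mul hdet.ne')

/-- A real symmetric matrix is orthogonally diagonalizable, with its `eigenvalues` on the
diagonal. -/
theorem Matrix.IsHermitian.exists_mul_eq_mul_diagonal_eigenvalues {ι : Type*} [Fintype ι]
    [DecidableEq ι] {A : Matrix ι ι ℝ} (hA : A.IsHermitian) :
    ∃ U : Matrix ι ι ℝ, Uᵀ * U = 1 ∧ A * U = U * diagonal hA.eigenvalues := by
  refine ⟨hA.eigenvectorUnitary, ?_, ?_⟩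
  · simpa [star_eq_conjTranspose] using Unitary.coe_star_mul_self hA.eigenvectorUnitary
  · ext i j
    have h := congrFun (hA.mulVec_eigenvectorBasis j) i
    rw [mul_diagonal, mul_apply]
    simpa [mulVec, dotProduct, mul_comm] using h

/-- Direct sum decomposition into biorthogonal invariant subspaces (matrix form):
there exist `X, Y` with `Xᵀ Y = I` and diagonal `Λ ≥ 0`, `D > 0` such that
`K X = Y Λ`, `M Y = X D`, with `D_{ii} = Λ_{ii}` when `Λ_{ii} > 0` and
`D_{ii} = 1` when `Λ_{ii} = 0`; the number of zero diagonal entries of `Λ`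
equals `dim ker K`. -/
theorem stmt12 (n : ℕ) (hn : 0 < n) (K M : Matrix (Fin n) (Fin n) ℝ)
    (hK : K.PosSemidef) (hM : M.PosDef) :
    ∃ (X Y Λ D : Matrix (Fin n) (Fin n) ℝ),
      Xᵀ * Y = 1 ∧ Λ.IsDiag ∧ D.IsDiag ∧
      (∀ i, 0 ≤ Λ i i) ∧ (∀ i, 0 < D i i) ∧
      K * X = Y * Λ ∧ M * Y = X * D ∧
      (∀ i, (0 < Λ i i → D i i = Λ i i) ∧ (Λ i i = 0 → D i i = 1)) ∧
      (Finset.univ.filter (fun i => Λ i i = 0)).card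
        = Module.finrank ℝ (LinearMap.ker K.mulVecLin) := by
  obtain ⟨B, hB, hMB⟩ := hM.exists_eq_mul_transpose
  have hBt : IsUnit Bᵀ.det := by rwa [det_transpose]
  have hA : (Bᵀ * K * B).PosSemidef := by
    simpa [conjTranspose_eq_transpose_of_trivial] using hK.conjTranspose_mul_mul_same B
  obtain ⟨U, hU, hAU⟩ := hA.1.exists_mul_eq_mul_diagonal_eigenvalues
  have hμ : ∀ i, 0 ≤ hA.1.eigenvalues i := hA.eigenvalues_nonneg
  have hrank : K.rank = Fintype.card {i // hA.1.eigenvalues i ≠ 0} := by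
    rw [← hA.1.rank_eq_card_non_zero_eigs, rank_mul_eq_left_of_isUnit_det _ _ hB,
      rank_mul_eq_right_of_isUnit_det _ _ hBt]
  generalize hA.1.eigenvalues = μ at hAU hμ hrank
  have hKBU : K * (B * U) = Bᵀ⁻¹ * U * diagonal μ := by
    rw [mul_assoc Bᵀ⁻¹, ← hAU, mul_assoc, mul_assoc, nonsing_inv_mul_cancel_left _ _ hBt]
  set d : Fin n → ℝ := fun i => if μ i = 0 then 1 else √(μ i) with hd
  have hd_pos : ∀ i, 0 < d i := fun i => by
    by_cases h : μ i = 0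
    · simp [hd, h]
    · simpa [hd, h] using lt_of_le_of_ne (hμ i) (Ne.symm h)
  have hd_mul : ∀ i, d i * √(μ i) = μ i := fun i => by
    by_cases h : μ i = 0
    · simp [h]
    · simp [hd, h, Real.mul_self_sqrt (hμ i)]
  have hs_pos : ∀ i, 0 < √(d i) := fun i => Real.sqrt_pos.mpr (hd_pos i)
  have hs : ∀ i, √(d i) * √(d i) = d i := fun i => Real.mul_self_sqrt (hd_pos i).le
  refine ⟨B * U * diagonal fun i => (√(d i))⁻¹, Bᵀ⁻¹ * U * diagonal fun i => √(d i),
    diagonal fun i => √(μ i), diagonal d, ?_, isDiag_diagonal _, isDiag_diagonal _,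
    ?_, ?_, ?_, ?_, ?_, ?_⟩
  · have hBU : Uᵀ * Bᵀ * (Bᵀ⁻¹ * U) = 1 := by
      rw [mul_assoc, mul_nonsing_inv_cancel_left _ _ hBt, hU]
    rw [transpose_mul, transpose_mul, diagonal_transpose, mul_assoc, ← mul_assoc (Uᵀ * Bᵀ),
      hBU, one_mul, diagonal_mul_diagonal, ← diagonal_one]
    exact congrArg diagonal (funext fun i => inv_mul_cancel₀ (hs_pos i).ne')
  · intro i
    simp
  · intro i
    simpa using hd_pos i
  · rw [← mul_assoc, hKBU, mul_assoc, mul_assoc (Bᵀ⁻¹ * U), diagonal_mul_diagonal,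
      diagonal_mul_diagonal]
    congr 2
    funext i
    rw [← div_eq_mul_inv, div_eq_iff (hs_pos i).ne', mul_right_comm, hs, hd_mul]
  · rw [hMB, mul_assoc B, mul_assoc Bᵀ⁻¹, mul_nonsing_inv_cancel_left _ _ hBt, ← mul_assoc,
      mul_assoc (B * U), diagonal_mul_diagonal]
    congr 2
    funext i
    rw [eq_inv_mul_iff_mul_eq₀ (hs_pos i).ne', hs]
  · intro i
    by_cases h : μ i = 0
    · simp [hd, h]
    · simp [hd, h, Real.sqrt_eq_zero (hμ i)]
  · have hker := K.mulVecLin.finrank_range_add_finrank_ker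
    have hcard := Finset.card_filter_add_card_filter_not (s := Finset.univ) (fun i => μ i = 0)
    change K.rank + _ = _ at hker
    rw [hrank, Fintype.card_subtype, Module.finrank_fin_fun] at hker
    rw [Finset.card_univ, Fintype.card_fin] at hcard
    simp only [diagonal_apply_eq, Real.sqrt_eq_zero (hμ _)]
    simp only [ne_eq] at hker
    omega
end

section
/- Minimization principles in the biorthogonal complement: let r = dim ker(K), and suppose vectors x⁰₁,…,x⁰_r, y⁰₁,…,y⁰_r ∈ ℝⁿ and, for i = 1,…,n−r, real numbers 0 < λ₁ ≤ λ₂ ≤ ⋯ ≤ λ_{n−r} and vectors x_i, y_i ∈ ℝⁿ are given such that K x⁰_i = 0 and M y⁰_i = x⁰_i for i ≤ r, K x_i = λ_i y_i and M y_i = λ_i x_i for i ≤ n−r, and the combined biorthogonality [x⁰₁,…,x⁰_r, x₁,…,x_{n−r}]ᵀ·[y⁰₁,…,y⁰_r, y₁,…,y_{n−r}] = I_n holds. Then for every k with 1 ≤ k ≤ n−r and every ℓ with 0 ≤ ℓ ≤ n−r−k, the quantity (1/2)·trace(Uᵀ K U + Vᵀ M V), minimized over all pairs of matrices U, V ∈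 ℝ^{n×k} satisfying Uᵀ V = I_k, (y⁰_i)ᵀ U = 0 and (x⁰_i)ᵀ V = 0 for all i ≤ r, and (y_i)ᵀ U = 0 and (x_i)ᵀ V = 0 for all i ≤ ℓ, equals Σ_{i=1}^{k} λ_{ℓ+i}; the minimum is attained at U = [x_{ℓ+1},…,x_{ℓ+k}], V = [y_{ℓ+1},…,y_{ℓ+k}]. -/
open Matrix

/-- A lower bound for the energy of a pair of vectors expanded in biorthogonal bases that
diagonalize both quadratic forms. -/
theorem le_half_energy_of_biorthogonal {m ι : Type*} [Fintype m] [Fintype ι] [DecidableEq m]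
    [DecidableEq ι] {K M : Matrix m m ℝ} {X Y : Matrix m ι ℝ} {κ μ : ι → ℝ}
    (hXY : Xᵀ * Y = 1) (hYX : Y * Xᵀ = 1)
    (hK : K * X = Y * diagonal κ) (hM : M * Y = X * diagonal μ)
    (hκ : ∀ i, 0 ≤ κ i) (hμ : ∀ i, 0 ≤ μ i) {c : ℝ} (hc : 0 ≤ c) {u v : m → ℝ}
    (huv : u ⬝ᵥ v = 1)
    (h : ∀ i, (Yᵀ *ᵥ u) i * (Xᵀ *ᵥ v) i = 0 ∨ (c ≤ κ i ∧ c ≤ μ i)) :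
    c ≤ 1 / 2 * (u ⬝ᵥ K *ᵥ u + v ⬝ᵥ M *ᵥ v) := by
  have hXY' : X * Yᵀ = 1 := by
    have := congrArg transpose hYX
    simpa using this
  set α := Yᵀ *ᵥ u with hα
  set β := Xᵀ *ᵥ v with hβ
  have hu : u = X *ᵥ α := by rw [hα, mulVec_mulVec, hXY', one_mulVec]
  have hv : v = Y *ᵥ β := by rw [hβ, mulVec_mulVec, hYX, one_mulVec]
  have pair : ∀ γ δ : ι → ℝ, (X *ᵥ γ) ⬝ᵥ (Y *ᵥ δ) = γ ⬝ᵥ δ := by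
    intro γ δ
    rw [dotProduct_mulVec, ← mulVec_transpose, mulVec_mulVec]
    have : Yᵀ * X = 1 := by simpa using congrArg transpose hXY
    rw [this, one_mulVec]
  have huv' : ∑ i, α i * β i = 1 := by
    rw [← huv, hu, hv, pair]; rfl
  have hKu : u ⬝ᵥ K *ᵥ u = ∑ i, κ i * α i ^ 2 := by
    rw [hu, mulVec_mulVec α, hK, ← mulVec_mulVec, pair, dotProduct]
    refine Finset.sum_congr rfl fun i _ => ?_
    rw [mulVec_diagonal]; ring
  have hMv : v ⬝ᵥ M *ᵥ v = ∑ i, μ i * β i ^ 2 := by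
    rw [hv, mulVec_mulVec β, hM, ← mulVec_mulVec, dotProduct_comm, pair, dotProduct]
    refine Finset.sum_congr rfl fun i _ => ?_
    rw [mulVec_diagonal]; ring
  rw [hKu, hMv, ← Finset.sum_add_distrib, Finset.mul_sum]
  calc c = ∑ i, c * (α i * β i) := by rw [← Finset.mul_sum, huv', mul_one]
    _ ≤ _ := Finset.sum_le_sum fun i _ => ?_
  rcases h i with h0 | ⟨h1, h2⟩
  · rw [h0]
    have := mul_nonneg (hκ i) (sq_nonneg (α i))
    have := mul_nonneg (hμ i) (sq_nonneg (β i))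
    linarith
  · have := mul_le_mul_of_nonneg_right h1 (sq_nonneg (α i))
    have := mul_le_mul_of_nonneg_right h2 (sq_nonneg (β i))
    nlinarith [mul_nonneg hc (sq_nonneg (α i - β i))]

/-- Any `k` vectors of `ℝᵏ` admit an orthogonal matrix whose `t`-th column is orthogonal to the
vectors with index smaller than `t`. -/
theorem exists_orthogonal_matrix_triangular {k : ℕ} (f : Fin k → Fin k → ℝ) :
    ∃ Q : Matrix (Fin k) (Fin k) ℝ, Qᵀ * Q = 1 ∧ ∀ i t, i < t → f i ⬝ᵥ Q.col t = 0 := by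
  let q := InnerProductSpace.gramSchmidtOrthonormalBasis (𝕜 := ℝ)
    (E := EuclideanSpace ℝ (Fin k)) (by simp) (fun i => WithLp.toLp 2 (f i))
  refine ⟨Matrix.of fun p t => q t p, ?_, fun i t hit => ?_⟩
  · ext i j
    have := orthonormal_iff_ite.mp q.orthonormal i j
    rw [Matrix.one_apply, ← this, Matrix.mul_apply]
    simp [PiLp.inner_apply, mul_comm]
  · have := InnerProductSpace.gramSchmidtOrthonormalBasis_inv_triangular (𝕜 := ℝ)
      (E := EuclideanSpace ℝ (Fin k)) (by simp) (fun i => WithLp.toLp 2 (f i)) hit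
    rw [PiLp.inner_apply] at this
    rw [← this, dotProduct]
    rfl

/-- The trace of `Uᵀ * N * U` as a sum of values of the quadratic form of `N` on columns. -/
theorem trace_transpose_mul_mul {m κ : Type*} [Fintype m] [Fintype κ] (N : Matrix m m ℝ)
    (U : Matrix m κ ℝ) : (Uᵀ * N * U).trace = ∑ t, U.col t ⬝ᵥ N *ᵥ U.col t := by
  refine Finset.sum_congr rfl fun t _ => ?_
  rw [diag_apply, Matrix.mul_assoc]
  rfl

/-- The trace of `Uᵀ * N * U` is invariant under orthogonal changes of the columns of `U`. -/
theorem trace_transpose_mul_mul_orthogonal {m κ : Type*} [Fintype m] [Fintype κ] [DecidableEq κ]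
    (N : Matrix m m ℝ) (U : Matrix m κ ℝ) {Q : Matrix κ κ ℝ} (hQ : Qᵀ * Q = 1) :
    ((U * Q)ᵀ * N * (U * Q)).trace = (Uᵀ * N * U).trace := by
  have hQ' : Q * Qᵀ = 1 := mul_eq_one_comm.mp hQ
  calc ((U * Q)ᵀ * N * (U * Q)).trace = (Qᵀ * (Uᵀ * N * U * Q)).trace := by
        simp only [transpose_mul, Matrix.mul_assoc]
    _ = _ := by rw [trace_mul_comm, Matrix.mul_assoc, hQ', Matrix.mul_one]

/-- Minimization principles in the biorthogonal complement: with `r = dim ker K`,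
generalized-nullspace vectors `x⁰_i, y⁰_i` and biorthogonal eigenvector pairs
`x_i, y_i` for the ordered positive eigenvalues `λ_i`, for every `1 ≤ k` and
`ℓ` with `ℓ + k ≤ n - r`, the minimum of `(1/2) trace(Uᵀ K U + Vᵀ M V)` over
pairs `U, V ∈ ℝ^{n×k}` with `Uᵀ V = I_k` that are biorthogonal to the
generalized nullspace and to the first `ℓ` eigenvector pairs equals
`λ_{ℓ+1} + ⋯ + λ_{ℓ+k}`, attained at `U = [x_{ℓ+1},…,x_{ℓ+k}]`,
`V = [y_{ℓ+1},…,y_{ℓ+k}]`. -/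
theorem stmt13 (n r : ℕ) (hn : 0 < n)
    (K M : Matrix (Fin n) (Fin n) ℝ) (hK : K.PosSemidef) (hM : M.PosDef)
    (hr : Module.finrank ℝ (LinearMap.ker K.mulVecLin) = r)
    (x0 y0 : Fin r → Fin n → ℝ)
    (lam : Fin (n - r) → ℝ) (x y : Fin (n - r) → Fin n → ℝ)
    (hx0 : ∀ i, K.mulVec (x0 i) = 0)
    (hy0 : ∀ i, M.mulVec (y0 i) = x0 i)
    (hlam_pos : ∀ i, 0 < lam i)
    (hlam_mono : Monotone lam)
    (hKx : ∀ i, K.mulVec (x i) = lam i • y i)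
    (hMy : ∀ i, M.mulVec (y i) = lam i • x i)
    (hbi : (Matrix.of fun (p : Fin n) (j : Fin r ⊕ Fin (n - r)) =>
          Sum.elim x0 x j p)ᵀ *
        Matrix.of (fun (p : Fin n) (j : Fin r ⊕ Fin (n - r)) =>
          Sum.elim y0 y j p) = 1)
    (k ℓ : ℕ) (hk : 1 ≤ k) (hℓk : ℓ + k ≤ n - r) :
    IsLeast
      { t : ℝ | ∃ U V : Matrix (Fin n) (Fin k) ℝ,
          Uᵀ * V = 1 ∧
          (∀ i : Fin r, Matrix.vecMul (y0 i) U = 0) ∧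
          (∀ i : Fin r, Matrix.vecMul (x0 i) V = 0) ∧
          (∀ i : Fin (n - r), (i : ℕ) < ℓ → Matrix.vecMul (y i) U = 0) ∧
          (∀ i : Fin (n - r), (i : ℕ) < ℓ → Matrix.vecMul (x i) V = 0) ∧
          t = (1 / 2) * (Uᵀ * K * U + Vᵀ * M * V).trace }
      (∑ i : Fin k, lam ⟨ℓ + (i : ℕ), by omega⟩) ∧
    (1 / 2) * ((Matrix.of fun (p : Fin n) (j : Fin k) =>
          x ⟨ℓ + (j : ℕ), by omega⟩ p)ᵀ * K *
        Matrix.of (fun (p : Fin n) (j : Fin k) =>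
          x ⟨ℓ + (j : ℕ), by omega⟩ p)
      + (Matrix.of fun (p : Fin n) (j : Fin k) =>
          y ⟨ℓ + (j : ℕ), by omega⟩ p)ᵀ * M *
        Matrix.of (fun (p : Fin n) (j : Fin k) =>
          y ⟨ℓ + (j : ℕ), by omega⟩ p)).trace
      = ∑ i : Fin k, lam ⟨ℓ + (i : ℕ), by omega⟩ := by
  have hrn : r ≤ n := by
    rw [← hr]
    simpa using Submodule.finrank_le (LinearMap.ker K.mulVecLin)
  have hdot : ∀ a b, Sum.elim x0 x a ⬝ᵥ Sum.elim y0 y b = if a = b then 1 else 0 :=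
    fun a b => congrFun (congrFun hbi a) b
  have hxy : ∀ i j, x i ⬝ᵥ y j = if i = j then 1 else 0 := fun i j => by
    simpa using hdot (Sum.inr i) (Sum.inr j)
  have hx0y : ∀ i j, x0 i ⬝ᵥ y j = 0 := fun i j => by
    simpa using hdot (Sum.inl i) (Sum.inr j)
  have hxy0 : ∀ i j, x i ⬝ᵥ y0 j = 0 := fun i j => by
    simpa using hdot (Sum.inr i) (Sum.inl j)
  have hval : (1 / 2) * ((Matrix.of fun (p : Fin n) (j : Fin k) =>
          x ⟨ℓ + (j : ℕ), by omega⟩ p)ᵀ * K *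
        Matrix.of (fun (p : Fin n) (j : Fin k) =>
          x ⟨ℓ + (j : ℕ), by omega⟩ p)
      + (Matrix.of fun (p : Fin n) (j : Fin k) =>
          y ⟨ℓ + (j : ℕ), by omega⟩ p)ᵀ * M *
        Matrix.of (fun (p : Fin n) (j : Fin k) =>
          y ⟨ℓ + (j : ℕ), by omega⟩ p)).trace
      = ∑ i : Fin k, lam ⟨ℓ + (i : ℕ), by omega⟩ := by
    rw [trace_add, trace_transpose_mul_mul, trace_transpose_mul_mul, ← Finset.sum_add_distrib,
      Finset.mul_sum]
    refine Finset.sum_congr rfl fun t _ => ?_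
    change 1 / 2 * (x ⟨ℓ + t, _⟩ ⬝ᵥ K *ᵥ x ⟨ℓ + t, _⟩ + y ⟨ℓ + t, _⟩ ⬝ᵥ M *ᵥ y ⟨ℓ + t, _⟩) = _
    rw [hKx, hMy, dotProduct_smul, dotProduct_smul, dotProduct_comm (y _), hxy, if_pos rfl]
    simp only [smul_eq_mul]
    ring
  refine ⟨⟨⟨_, _, ?_, ?_, ?_, ?_, ?_, hval.symm⟩, ?_⟩, hval⟩
  · ext i j
    refine (hxy _ _).trans ?_
    simp [Matrix.one_apply, Fin.ext_iff]
  · exact fun i => funext fun j => (dotProduct_comm _ _).trans (hxy0 _ i)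
  · exact fun i => funext fun j => hx0y i _
  · refine fun i hi => funext fun j => (dotProduct_comm _ _).trans ((hxy _ i).trans (if_neg ?_))
    rintro rfl
    simp at hi
  · refine fun i hi => funext fun j => (hxy i _).trans (if_neg ?_)
    rintro rfl
    simp at hi
  rintro _ ⟨U, V, hUV, hU0, hV0, hUl, hVl, rfl⟩
  obtain ⟨Q, hQ, hQf⟩ := exists_orthogonal_matrix_triangular
    (fun i : Fin k => y ⟨ℓ + (i : ℕ), by omega⟩ ᵥ* U)
  have hQ' : Q * Qᵀ = 1 := mul_eq_one_comm.mp hQ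
  have hWZ : (U * Q)ᵀ * (V * Q) = 1 := by
    rw [transpose_mul, Matrix.mul_assoc, ← Matrix.mul_assoc Uᵀ, hUV, Matrix.one_mul, hQ]
  rw [trace_add, ← trace_transpose_mul_mul_orthogonal K U hQ,
    ← trace_transpose_mul_mul_orthogonal M V hQ, trace_transpose_mul_mul,
    trace_transpose_mul_mul, ← Finset.sum_add_distrib, Finset.mul_sum]
  have hcolU : ∀ (w : Fin n → ℝ) (t : Fin k), w ⬝ᵥ (U * Q).col t = (w ᵥ* U) ⬝ᵥ Q.col t :=
    fun w t => dotProduct_mulVec w U (Q.col t)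
  have hcolV : ∀ (w : Fin n → ℝ) (t : Fin k), w ⬝ᵥ (V * Q).col t = (w ᵥ* V) ⬝ᵥ Q.col t :=
    fun w t => dotProduct_mulVec w V (Q.col t)
  refine Finset.sum_le_sum fun t _ => ?_
  refine le_half_energy_of_biorthogonal (κ := Sum.elim (fun _ => 0) lam)
    (μ := Sum.elim (fun _ => 1) lam) hbi ?_ ?_ ?_ ?_ ?_ (hlam_pos _).le ?_ ?_
  · exact (mul_eq_one_comm_of_card_eq _ _ _ (by simp; omega)).mp hbi
  · ext p j
    rw [mul_diagonal]
    rcases j with j | j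
    · exact (congrFun (hx0 j) p).trans (by simp)
    · exact (congrFun (hKx j) p).trans (by simp [mul_comm])
  · ext p j
    rw [mul_diagonal]
    rcases j with j | j
    · exact (congrFun (hy0 j) p).trans (by simp)
    · exact (congrFun (hMy j) p).trans (by simp [mul_comm])
  · rintro (i | i)
    · exact le_rfl
    · exact (hlam_pos i).le
  · rintro (i | i)
    · exact zero_le_one
    · exact (hlam_pos i).le
  · exact (congrFun (congrFun hWZ t) t).trans (one_apply_eq t)
  · rintro (i | i)
    · left
      refine mul_eq_zero_of_left ?_ _
      change y0 i ⬝ᵥ (U * Q).col t = 0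
      rw [hcolU, hU0, zero_dotProduct]
    · by_cases hi : (i : ℕ) < ℓ + t
      · left
        refine mul_eq_zero_of_left ?_ _
        change y i ⬝ᵥ (U * Q).col t = 0
        rw [hcolU]
        by_cases hil : (i : ℕ) < ℓ
        · rw [hUl i hil, zero_dotProduct]
        · have hlt : (i : ℕ) - ℓ < k := by omega
          have := hQf ⟨i - ℓ, hlt⟩ t (by rw [Fin.lt_def]; simp; omega)
          have he : (⟨ℓ + ((⟨i - ℓ, hlt⟩ : Fin k) : ℕ), by simp; omega⟩ : Fin (n - r)) = i := by
            ext; simp; omega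
          simpa only [he] using this
      · right
        have : lam ⟨ℓ + t, by omega⟩ ≤ lam i := hlam_mono (by rw [Fin.le_def]; simp; omega)
        exact ⟨this, this⟩
end

section
/- Diagonal trace minimization principle: let m ≥ k ≥ 1 be integers and Λ = diag(λ₁,…,λ_m) with 0 < λ₁ ≤ λ₂ ≤ ⋯ ≤ λ_m. Then the minimum of (1/2)·trace(Cᵀ Λ C + Dᵀ Λ D) over all pairs of matrices C, D ∈ ℝ^{m×k} with Cᵀ D = I_k equals Σ_{i=1}^{k} λ_i, and the minimum is attained at C = D = [I_k; O] (the first k columns of the m×m identity matrix). -/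
open Matrix

/-- Over an orthonormal basis obtained by Gram–Schmidt from the first `k` rows of `D`, the
matrix `D` becomes lower triangular. -/
lemma exists_orthogonal_mul_lowerTriangular {m k : ℕ} (hkm : k ≤ m)
    (D : Matrix (Fin m) (Fin k) ℝ) :
    ∃ U : Matrix (Fin k) (Fin k) ℝ, Uᵀ * U = 1 ∧
      ∀ (i : Fin m) (l : Fin k), (i : ℕ) < l → (D * U) i l = 0 := by
  let f : Fin k → EuclideanSpace ℝ (Fin k) := fun i => WithLp.toLp 2 (D (Fin.castLE hkm i))
  have hcard : Module.finrank ℝ (EuclideanSpace ℝ (Fin k)) = Fintype.card (Fin k) := by simp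
  let b := InnerProductSpace.gramSchmidtOrthonormalBasis hcard f
  refine ⟨Matrix.of fun j l => b l j, ?_, fun i l hil => ?_⟩
  · ext l l'
    have h := orthonormal_iff_ite.mp b.orthonormal l' l
    simp only [PiLp.inner_apply, RCLike.inner_apply, conj_trivial] at h
    simp only [Matrix.mul_apply, Matrix.transpose_apply, Matrix.of_apply, Matrix.one_apply, h,
      eq_comm]
  · have h := InnerProductSpace.gramSchmidtOrthonormalBasis_inv_triangular hcard f
      (i := ⟨i, hil.trans l.isLt⟩) (j := l) hil
    simpa [Matrix.mul_apply, PiLp.inner_apply, f, b] using h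

/-- The quadratic trace form is unchanged by right multiplication with an orthogonal matrix. -/
lemma trace_transpose_mul_mul_orthogonal_s14 {m k : ℕ} {U : Matrix (Fin k) (Fin k) ℝ}
    (hU : Uᵀ * U = 1) (A : Matrix (Fin m) (Fin m) ℝ) (C : Matrix (Fin m) (Fin k) ℝ) :
    ((C * U)ᵀ * A * (C * U)).trace = (Cᵀ * A * C).trace := by
  have hU' : U * Uᵀ = 1 := mul_eq_one_comm.mp hU
  rw [← Matrix.mul_assoc, Matrix.trace_mul_comm, Matrix.transpose_mul]
  simp only [← Matrix.mul_assoc, hU', Matrix.one_mul]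

lemma trace_transpose_mul_diagonal_mul {m k : ℕ} (lam : Fin m → ℝ)
    (C : Matrix (Fin m) (Fin k) ℝ) :
    (Cᵀ * Matrix.diagonal lam * C).trace = ∑ l, ∑ i, lam i * C i l ^ 2 := by
  refine Finset.sum_congr rfl fun l _ => ?_
  rw [Matrix.diag_apply, Matrix.mul_apply]
  refine Finset.sum_congr rfl fun i _ => ?_
  rw [Matrix.mul_diagonal, Matrix.transpose_apply]
  ring

lemma sum_le_half_trace {m k : ℕ} (hkm : k ≤ m) (lam : Fin m → ℝ) (hpos : ∀ i, 0 ≤ lam i)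
    (hmono : Monotone lam) (C D : Matrix (Fin m) (Fin k) ℝ) (hCD : Cᵀ * D = 1) :
    ∑ i : Fin k, lam (Fin.castLE hkm i) ≤
      (1 / 2) * (Cᵀ * Matrix.diagonal lam * C + Dᵀ * Matrix.diagonal lam * D).trace := by
  obtain ⟨U, hU, hlow⟩ := exists_orthogonal_mul_lowerTriangular hkm D
  have hone : (C * U)ᵀ * (D * U) = 1 := by
    rw [Matrix.transpose_mul, Matrix.mul_assoc, ← Matrix.mul_assoc Cᵀ, hCD, Matrix.one_mul, hU]
  rw [Matrix.trace_add, ← trace_transpose_mul_mul_orthogonal_s14 hU _ C,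
    ← trace_transpose_mul_mul_orthogonal_s14 hU _ D, trace_transpose_mul_diagonal_mul,
    trace_transpose_mul_diagonal_mul, ← Finset.sum_add_distrib, Finset.mul_sum]
  refine Finset.sum_le_sum fun l _ => ?_
  have hl : ∑ i, (C * U) i l * (D * U) i l = 1 := by
    have h := congr_fun (congr_fun hone l) l
    rwa [Matrix.mul_apply, Matrix.one_apply_eq] at h
  have hsum : lam (Fin.castLE hkm l) =
      ∑ i, lam (Fin.castLE hkm l) * ((C * U) i l * (D * U) i l) := by
    rw [← Finset.mul_sum, hl, mul_one]
  rw [← Finset.sum_add_distrib, Finset.mul_sum, hsum]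
  refine Finset.sum_le_sum fun i _ => ?_
  rcases lt_or_ge (i : ℕ) l with hil | hil
  · rw [hlow i l hil]
    have := mul_nonneg (hpos i) (sq_nonneg ((C * U) i l))
    nlinarith
  · have hle : lam (Fin.castLE hkm l) ≤ lam i := hmono hil
    have := hpos (Fin.castLE hkm l)
    nlinarith [mul_nonneg this (sq_nonneg ((C * U) i l - (D * U) i l)),
      mul_nonneg (sub_nonneg.mpr hle) (sq_nonneg ((C * U) i l)),
      mul_nonneg (sub_nonneg.mpr hle) (sq_nonneg ((D * U) i l))]

lemma transpose_mul_self_firstColumns {m k : ℕ} (hkm : k ≤ m) :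
    (Matrix.of fun (i : Fin m) (j : Fin k) => if (i : ℕ) = (j : ℕ) then (1 : ℝ) else 0)ᵀ *
      Matrix.of (fun (i : Fin m) (j : Fin k) => if (i : ℕ) = (j : ℕ) then (1 : ℝ) else 0) = 1 := by
  ext l l'
  have h : ∀ (i : Fin m) (l : Fin k), (i : ℕ) = l ↔ i = Fin.castLE hkm l :=
    fun i l => by simp [Fin.ext_iff]
  simp [Matrix.mul_apply, Matrix.one_apply, h, eq_comm]

lemma trace_firstColumns {m k : ℕ} (hkm : k ≤ m) (lam : Fin m → ℝ) :
    ((Matrix.of fun (i : Fin m) (j : Fin k) => if (i : ℕ) = (j : ℕ) then (1 : ℝ) else 0)ᵀ *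
      Matrix.diagonal lam *
      Matrix.of (fun (i : Fin m) (j : Fin k) =>
        if (i : ℕ) = (j : ℕ) then (1 : ℝ) else 0)).trace = ∑ i, lam (Fin.castLE hkm i) := by
  have h : ∀ (i : Fin m) (l : Fin k), (i : ℕ) = l ↔ i = Fin.castLE hkm l :=
    fun i l => by simp [Fin.ext_iff]
  simp [trace_transpose_mul_diagonal_mul, h]

/-- Diagonal trace minimization principle: for `Λ = diag(λ₁ ≤ ⋯ ≤ λ_m)` with all
`λ_i > 0`, the minimum of `(1/2) trace(Cᵀ Λ C + Dᵀ Λ D)` over `Cᵀ D = I_k` equals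
`λ₁ + ⋯ + λ_k`, attained at `C = D = [I_k; O]`. -/
theorem stmt14 (m k : ℕ) (hk : 1 ≤ k) (hkm : k ≤ m)
    (lam : Fin m → ℝ) (hpos : ∀ i, 0 < lam i) (hmono : Monotone lam) :
    IsLeast
      { t : ℝ | ∃ C D : Matrix (Fin m) (Fin k) ℝ, Cᵀ * D = 1 ∧
          t = (1 / 2) * (Cᵀ * Matrix.diagonal lam * C
            + Dᵀ * Matrix.diagonal lam * D).trace }
      (∑ i : Fin k, lam (Fin.castLE hkm i)) ∧
    ((Matrix.of fun (i : Fin m) (j : Fin k) =>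
        if (i : ℕ) = (j : ℕ) then (1 : ℝ) else 0)ᵀ *
      Matrix.of (fun (i : Fin m) (j : Fin k) =>
        if (i : ℕ) = (j : ℕ) then (1 : ℝ) else 0) = 1) ∧
    (1 / 2) * ((Matrix.of fun (i : Fin m) (j : Fin k) =>
          if (i : ℕ) = (j : ℕ) then (1 : ℝ) else 0)ᵀ * Matrix.diagonal lam *
        Matrix.of (fun (i : Fin m) (j : Fin k) =>
          if (i : ℕ) = (j : ℕ) then (1 : ℝ) else 0)
      + (Matrix.of fun (i : Fin m) (j : Fin k) =>
          if (i : ℕ) = (j : ℕ) then (1 : ℝ) else 0)ᵀ * Matrix.diagonal lam *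
        Matrix.of (fun (i : Fin m) (j : Fin k) =>
          if (i : ℕ) = (j : ℕ) then (1 : ℝ) else 0)).trace
      = ∑ i : Fin k, lam (Fin.castLE hkm i) := by
  have hval := trace_firstColumns hkm lam
  have hone := transpose_mul_self_firstColumns hkm
  refine ⟨⟨⟨_, _, hone, ?_⟩, ?_⟩, hone, ?_⟩
  · rw [Matrix.trace_add, hval]
    ring
  · rintro t ⟨C, D, hCD, rfl⟩
    exact sum_le_half_trace hkm lam (fun i => (hpos i).le) hmono C D hCD
  · rw [Matrix.trace_add, hval]
    ring
end

section
/- For every invertible matrix C ∈ ℝ^{k×k} and every diagonal matrix Λ ∈ ℝ^{k×k} with positive diagonal entries, setting D = (Cᵀ)^{-1} one has (1/2)·trace(Cᵀ Λ C + Dᵀ Λ D) ≥ trace(Λ). (This follows from the singular value decomposition C = Q Σ Pᵀ and the elementary inequality Σ² + Σ^{-2} ⪰ 2 I.) -/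
open Matrix

/-- For invertible `C` and diagonal `Λ > 0`, with `D = (Cᵀ)⁻¹`,
`(1/2) trace(Cᵀ Λ C + Dᵀ Λ D) ≥ trace(Λ)`. -/
theorem stmt15 (k : ℕ) (C : Matrix (Fin k) (Fin k) ℝ) (hC : IsUnit C.det)
    (lam : Fin k → ℝ) (hpos : ∀ i, 0 < lam i) :
    (Matrix.diagonal lam).trace ≤
      (1 / 2) * (Cᵀ * Matrix.diagonal lam * C
        + ((Cᵀ)⁻¹)ᵀ * Matrix.diagonal lam * (Cᵀ)⁻¹).trace := by
  have hT : IsUnit Cᵀ.det := by rwa [det_transpose]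
  set D := (Cᵀ)⁻¹
  have hDC : D * Cᵀ = 1 := nonsing_inv_mul _ hT
  have hCD : C * Dᵀ = 1 := by
    rw [← transpose_transpose (C * Dᵀ), transpose_mul, transpose_transpose, hDC, transpose_one]
  have hnonneg : 0 ≤ ((C - D)ᵀ * diagonal lam * (C - D)).trace := by
    have h := ((PosSemidef.diagonal fun i => (hpos i).le).conjTranspose_mul_mul_same
      (C - D)).trace_nonneg
    rwa [conjTranspose_eq_transpose_of_trivial] at h
  have hcross₁ : (Cᵀ * diagonal lam * D).trace = (diagonal lam).trace := by
    rw [trace_mul_comm, ← Matrix.mul_assoc, hDC, Matrix.one_mul]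
  have hcross₂ : (Dᵀ * diagonal lam * C).trace = (diagonal lam).trace := by
    rw [trace_mul_comm, ← Matrix.mul_assoc, hCD, Matrix.one_mul]
  simp only [transpose_sub, Matrix.sub_mul, Matrix.mul_sub, trace_sub, hcross₁, hcross₂]
    at hnonneg
  rw [trace_add]
  linarith
end

section
/- Positive definiteness of the projected blocks: let U, V ∈ ℝ^{n×d} satisfy Uᵀ V = I_d, and suppose Vᵀ x = 0 for every x ∈ ℝⁿ with K x = 0 (the columns of V are orthogonal to the nullspace of K). Then Uᵀ K U is symmetric positive definite, and Vᵀ M V is symmetric positive definite. -/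
open Matrix

/-- If `Uᵀ V = I_d` and the columns of `V` are orthogonal to the nullspace of `K`,
then `Uᵀ K U` and `Vᵀ M V` are both symmetric positive definite. -/
theorem stmt16 (n d : ℕ) (hd : 1 ≤ d) (hdn : d ≤ n)
    (K M : Matrix (Fin n) (Fin n) ℝ) (hK : K.PosSemidef) (hM : M.PosDef)
    (U V : Matrix (Fin n) (Fin d) ℝ) (hUV : Uᵀ * V = 1)
    (hker : ∀ x : Fin n → ℝ, K.mulVec x = 0 → Vᵀ.mulVec x = 0) :
    (Uᵀ * K * U).PosDef ∧ (Vᵀ * M * V).PosDef := by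
  have hVU : Vᵀ * U = 1 := by
    simpa using congrArg transpose hUV
  constructor
  · have hS : (Uᵀ * K * U).PosSemidef := by
      simpa using hK.conjTranspose_mul_mul_same U
    refine PosDef.of_dotProduct_mulVec_pos hS.isHermitian fun x hx => ?_
    refine lt_of_le_of_ne (hS.dotProduct_mulVec_nonneg x) fun h => hx ?_
    have hKU : K *ᵥ (U *ᵥ x) = 0 := by
      rw [← hK.dotProduct_mulVec_zero_iff, h, star_mulVec, conjTranspose_eq_transpose_of_trivial,
        ← dotProduct_mulVec, mulVec_mulVec, mulVec_mulVec, Matrix.mul_assoc]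
    simpa [hVU] using hker _ hKU
  · have hV : Function.Injective V.mulVec := fun x y h => by
      simpa [hUV] using congrArg (Uᵀ *ᵥ ·) h
    simpa using hM.conjTranspose_mul_mul_same hV
end
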